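/- Let Λ be a ring with 1 whose underlying additive group is a free ℤ-module of finite positive rank and such that Λ⊗ℚ is a semisimple ℚ-algebra, and let M be a free abelian group of finite positive rank equipped with a right Λ-module structure which is locally free of rank 1 (i.e., for every prime ℓ the right Λ⊗ℤ_ℓ-module M⊗ℤ_ℓ is free of rank 1). Then M is a projective right Λ-module; more precisely, M is isomorphic as a right Λ-module to a direct summand of the free right Λ-module Λ ⊕ Λ of rank 2. -/

import Mathlib

/-!
STATEMENT 0. A right module over a ring `Λ` is formalized as a module over the opposite
ring `Λᵐᵒᵖ`; accordingly, a right module over the base change `Λ ⊗ ℤ_ℓ` is formalized as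
a module over `Λᵐᵒᵖ ⊗[ℤ] ℤ_[ℓ]`.  The module structure of `Λᵐᵒᵖ ⊗[ℤ] S` on `M ⊗[ℤ] S`
(for a commutative ring `S`) is the canonical one: `Λᵐᵒᵖ` acts on the first factor and
`S` by multiplication on the second factor; it is constructed below.
"Free of rank 1" is expressed as the existence of a basis indexed by `Fin 1`.
-/

open scoped TensorProduct

namespace AlmostIso

variable (A S M : Type*) [Ring A] [CommRing S] [AddCommGroup M] [Module A M]

/-- Multiplication by elements of `S` on the second factor of `M ⊗[ℤ] S`,
as a ring homomorphism into `ℤ`-linear endomorphisms. -/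
noncomputable def rmulHom : S →+* Module.End ℤ (M ⊗[ℤ] S) where
  toFun s := LinearMap.lTensor M (LinearMap.mulLeft ℤ s)
  map_one' := by
    change (LinearMap.lTensor M (LinearMap.mulLeft ℤ (1 : S)) : M ⊗[ℤ] S →ₗ[ℤ] M ⊗[ℤ] S) = LinearMap.id
    rw [LinearMap.mulLeft_one, LinearMap.lTensor_id]
  map_mul' s t := by
    change (LinearMap.lTensor M (LinearMap.mulLeft ℤ (s * t)) : M ⊗[ℤ] S →ₗ[ℤ] M ⊗[ℤ] S) =
      (LinearMap.lTensor M (LinearMap.mulLeft ℤ s)).comp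
        (LinearMap.lTensor M (LinearMap.mulLeft ℤ t))
    rw [LinearMap.mulLeft_mul, LinearMap.lTensor_comp]
  map_zero' := by
    change (LinearMap.lTensor M (LinearMap.mulLeft ℤ (0 : S)) : M ⊗[ℤ] S →ₗ[ℤ] M ⊗[ℤ] S) = 0
    rw [LinearMap.mulLeft_zero_eq_zero, LinearMap.lTensor_zero]
  map_add' s t := by
    change (LinearMap.lTensor M (LinearMap.mulLeft ℤ (s + t)) : M ⊗[ℤ] S →ₗ[ℤ] M ⊗[ℤ] S) =
      LinearMap.lTensor M (LinearMap.mulLeft ℤ s) + LinearMap.lTensor M (LinearMap.mulLeft ℤ t)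
    have h : LinearMap.mulLeft ℤ (s + t) = LinearMap.mulLeft ℤ s + LinearMap.mulLeft ℤ t := by
      ext x; simp [add_mul]
    rw [h, LinearMap.lTensor_add]

theorem commute_lsmul_rmul (a : A) (s : S) :
    Commute ((Algebra.lsmul ℤ ℤ (M ⊗[ℤ] S) : A →ₐ[ℤ] Module.End ℤ (M ⊗[ℤ] S)) a)
      ((rmulHom S M).toIntAlgHom s) := by
  refine LinearMap.ext fun x => ?_
  induction x using TensorProduct.induction_on with
  | zero => simp [Module.End.mul_apply]
  | tmul m t =>
      have h (u : M) : rmulHom S M s (u ⊗ₜ[ℤ] t) = u ⊗ₜ[ℤ] (s * t) := rfl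
      simp [Module.End.mul_apply, h, RingHom.toIntAlgHom_apply,
        TensorProduct.smul_tmul']
  | add x y hx hy =>
      simp only [Module.End.mul_apply, map_add] at hx hy ⊢
      rw [hx, hy]

/-- The base change `M ⊗[ℤ] S` of a module `M` over `A` is a module over
`A ⊗[ℤ] S`: `A` acts on the first factor and `S` by multiplication on the second. -/
noncomputable instance bcModule : Module (A ⊗[ℤ] S) (M ⊗[ℤ] S) :=
  Module.compHom _
    (Algebra.TensorProduct.lift (Algebra.lsmul ℤ ℤ (M ⊗[ℤ] S))
      (rmulHom S M).toIntAlgHom (commute_lsmul_rmul A S M)).toRingHom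

end AlmostIso

namespace AlmostIso

section IsGeneratorMod

variable {R M : Type*} [Ring R] [AddCommGroup M] [Module R M]

/-- The map `r ↦ r • x` from `R` to `M` is an isomorphism modulo `p`. -/
structure IsGeneratorMod (R : Type*) {M : Type*} [Ring R] [AddCommGroup M] [Module R M]
    (p : ℤ) (x : M) : Prop where
  exists_eq_add (m : M) : ∃ (r : R) (m' : M), m = r • x + p • m'
  exists_eq_smul (r : R) (m : M) : r • x = p • m → ∃ r' : R, r = p • r'

theorem IsGeneratorMod.of_smul_add {p u : ℤ} (hu : IsCoprime u p) {x z : M}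
    (hx : IsGeneratorMod R p x) : IsGeneratorMod R p (u • x + p • z) := by
  obtain ⟨a, b, hab⟩ := hu
  constructor
  · intro m
    obtain ⟨r, m', rfl⟩ := hx.exists_eq_add m
    refine ⟨a • r, b • r • x - a • r • z + m', ?_⟩
    calc r • x + p • m' = (a * u + b * p) • r • x + p • m' := by rw [hab, one_smul]
      _ = a • u • r • x + a • p • r • z + p • (b • r • x - a • r • z + m') := by
        generalize r • x = v, r • z = w
        module
      _ = (a • r) • (u • x + p • z) + p • (b • r • x - a • r • z + m') := by
        rw [smul_assoc, smul_add r, smul_comm r u, smul_comm r p, smul_add a]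
  · intro r m hrm
    obtain ⟨r', hr'⟩ := hx.exists_eq_smul (u • r) (m - r • z) (by
      rw [smul_sub, ← hrm, smul_add, smul_comm r u, smul_comm r p, smul_assoc]
      abel)
    refine ⟨a • r' + b • r, ?_⟩
    calc r = (a * u + b * p) • r := by rw [hab, one_smul]
      _ = a • u • r + (b * p) • r := by module
      _ = p • (a • r' + b • r) := by rw [hr']; module

/-- If a finitely generated abelian group `A` equals `N + p • A`, then some integer coprime
to `p` maps `A` into `N`. -/
theorem exists_isCoprime_forall_smul_mem {A : Type*} [AddCommGroup A] [Module.Finite ℤ A]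
    (p : ℤ) (N : Submodule ℤ A) (h : ∀ a : A, ∃ y ∈ N, ∃ a', a = y + p • a') :
    ∃ n : ℤ, IsCoprime n p ∧ ∀ a : A, n • a ∈ N := by
  obtain ⟨n, hn, hN⟩ := Submodule.exists_sub_one_mem_and_smul_eq_zero_of_fg_of_le_smul
    (Ideal.span {p}) (⊤ : Submodule ℤ (A ⧸ N)) Module.Finite.fg_top (by
      rintro c -
      obtain ⟨a, rfl⟩ := N.mkQ_surjective c
      obtain ⟨y, hy, a', rfl⟩ := h a
      have : N.mkQ (y + p • a') = p • N.mkQ a' := by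
        simp [(Submodule.Quotient.mk_eq_zero N).2 hy]
      rw [this]
      exact Submodule.smul_mem_smul (Ideal.mem_span_singleton_self p) trivial)
  obtain ⟨c, hc⟩ := Ideal.mem_span_singleton.1 hn
  refine ⟨n, ⟨1, -c, by linear_combination hc⟩, fun a => ?_⟩
  rw [← Submodule.Quotient.mk_eq_zero N]
  exact hN (N.mkQ a) trivial

theorem IsGeneratorMod.injective [Module.Free ℤ R] [Module.Finite ℤ R] [Module.Free ℤ M]
    {p : ℤ} (hp : Prime p) {x : M} (hx : IsGeneratorMod R p x) :
    Function.Injective (LinearMap.toSpanSingleton R M x) := by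
  let K := (LinearMap.ker (LinearMap.toSpanSingleton R M x)).restrictScalars ℤ
  obtain ⟨n, hn, hK⟩ := exists_isCoprime_forall_smul_mem p (⊥ : Submodule ℤ K) (by
    rintro ⟨r, hr⟩
    have hr : r • x = 0 := by simpa [K] using hr
    obtain ⟨r', rfl⟩ := hx.exists_eq_smul r 0 (by simpa using hr)
    have hr' : r' • x = 0 := by
      rw [smul_assoc] at hr
      exact (smul_eq_zero.1 hr).resolve_left hp.ne_zero
    exact ⟨0, zero_mem _, ⟨r', by simpa [K] using hr'⟩, by ext; simp⟩)
  have hn0 : n ≠ 0 := by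
    rintro rfl
    exact hp.not_isUnit (isCoprime_zero_left.1 hn)
  rw [← LinearMap.ker_eq_bot, LinearMap.ker_eq_bot']
  intro r hr
  have h := congrArg Subtype.val ((Submodule.mem_bot ℤ).1 (hK ⟨r, hr⟩))
  exact (smul_eq_zero.1 (show n • r = 0 from h)).resolve_left hn0

theorem IsGeneratorMod.exists_comp_eq_smul [Module.Free ℤ R] [Module.Finite ℤ R]
    [Module.Free ℤ M] [Module.Finite ℤ M] {p : ℤ} (hp : Prime p) {x : M}
    (hx : IsGeneratorMod R p x) :
    ∃ n : ℤ, IsCoprime n p ∧ ∃ g : M →ₗ[R] R, ∀ m, g m • x = n • m := by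
  obtain ⟨n, hn, hM⟩ := exists_isCoprime_forall_smul_mem p
    ((LinearMap.range (LinearMap.toSpanSingleton R M x)).restrictScalars ℤ) (fun m => by
      obtain ⟨r, m', h⟩ := hx.exists_eq_add m
      exact ⟨r • x, ⟨r, rfl⟩, m', h⟩)
  let e := LinearEquiv.ofInjective _ (hx.injective hp)
  refine ⟨n, hn, e.symm.toLinearMap.comp
    ((n • (LinearMap.id : M →ₗ[R] M)).codRestrict _ hM), fun m => ?_⟩
  exact congrArg Subtype.val (e.apply_symm_apply ⟨n • m, hM m⟩)

theorem exists_forall_isGeneratorMod (S : Finset ℕ) (hS : ∀ p ∈ S, p.Prime)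
    (h : ∀ p : ℕ, p.Prime → ∃ x : M, IsGeneratorMod R p x) :
    ∃ x : M, ∀ p ∈ S, IsGeneratorMod R p x := by
  choose! x hx using h
  refine ⟨∑ p ∈ S, ((∏ q ∈ S.erase p, q : ℕ) : ℤ) • x p, fun p hp => ?_⟩
  have hdvd : ∀ q ∈ S.erase p, ∃ z : M,
      ((∏ l ∈ S.erase q, l : ℕ) : ℤ) • x q = (p : ℤ) • z := fun q hq => by
    obtain ⟨c, hc⟩ := Finset.dvd_prod_of_mem (fun l : ℕ => l)
      (Finset.mem_erase.2 ⟨(Finset.ne_of_mem_erase hq).symm, hp⟩)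
    exact ⟨(c : ℤ) • x q, by rw [hc, Nat.cast_mul, mul_smul]⟩
  choose! z hz using hdvd
  rw [← Finset.add_sum_erase S _ hp, Finset.sum_congr rfl hz, ← Finset.smul_sum]
  refine (hx p (hS p hp)).of_smul_add (Nat.isCoprime_iff_coprime.2 ?_)
  refine Nat.Coprime.prod_left fun q hq => ?_
  exact (Nat.coprime_primes (hS q (Finset.mem_of_mem_erase hq)) (hS p hp)).2
    (Finset.ne_of_mem_erase hq)

theorem exists_split_of_isGeneratorMod [Module.Free ℤ R] [Module.Finite ℤ R]
    [Module.Free ℤ M] [Module.Finite ℤ M]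
    (h : ∀ p : ℕ, p.Prime → ∃ x : M, IsGeneratorMod R p x) :
    ∃ (i : M →ₗ[R] R × R) (p : (R × R) →ₗ[R] M), p.comp i = LinearMap.id := by
  obtain ⟨x, hx⟩ := h 2 Nat.prime_two
  obtain ⟨n, hn, f, hf⟩ := hx.exists_comp_eq_smul Int.prime_two
  have hn0 : n ≠ 0 := by
    rintro rfl
    exact Int.prime_two.not_isUnit (isCoprime_zero_left.1 hn)
  obtain ⟨y, hy⟩ := exists_forall_isGeneratorMod n.natAbs.primeFactors
    (fun p => Nat.prime_of_mem_primeFactors) h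
  suffices ∃ k : ℤ, IsCoprime k n ∧ ∃ g : M →ₗ[R] R, ∀ m, g m • y = k • m by
    obtain ⟨k, ⟨a, b, hab⟩, g, hg⟩ := this
    refine ⟨(b • f).prod (a • g),
      (LinearMap.toSpanSingleton R M x).coprod (LinearMap.toSpanSingleton R M y),
      LinearMap.ext fun m => ?_⟩
    calc (b • f m) • x + (a • g m) • y = (a * k + b * n) • m := by
          rw [smul_assoc, smul_assoc, hf, hg]; module
      _ = m := by rw [hab, one_smul]
  let I : Ideal ℤ :=
    { carrier := {k | ∃ g : M →ₗ[R] R, ∀ m, g m • y = k • m}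
      zero_mem' := ⟨0, by simp⟩
      add_mem' := by
        rintro k l ⟨g, hg⟩ ⟨g', hg'⟩
        exact ⟨g + g', fun m => by rw [LinearMap.add_apply, add_smul, hg, hg', add_smul]⟩
      smul_mem' := by
        rintro c k ⟨g, hg⟩
        exact ⟨c • g, fun m => by rw [LinearMap.smul_apply, smul_assoc, hg, smul_assoc]⟩ }
  obtain ⟨k, hk⟩ := IsPrincipalIdealRing.principal I
  refine ⟨k, ?_, show k ∈ I from hk ▸ Submodule.mem_span_singleton_self k⟩
  rw [Int.isCoprime_iff_gcd_eq_one]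
  by_contra hkn
  obtain ⟨q, hq, hqk, hqn⟩ := Nat.Prime.not_coprime_iff_dvd.1 hkn
  have hqZ := Nat.prime_iff_prime_int.1 hq
  obtain ⟨l, hl, hlI⟩ := (hy q (Nat.mem_primeFactors.2
    ⟨hq, hqn, Int.natAbs_ne_zero.2 hn0⟩)).exists_comp_eq_smul hqZ
  have hlI : l ∈ Ideal.span {k} := hk.le hlI
  exact hqZ.not_isUnit (hl.isUnit_of_dvd'
    ((Int.natCast_dvd.2 hqk).trans (Ideal.mem_span_singleton.1 hlI)) dvd_rfl)

end IsGeneratorMod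

section Local

variable {R M : Type*} [Ring R] [AddCommGroup M] [Module R M]

theorem tmul_smul_tmul {S : Type*} [CommRing S] (r : R) (s : S) (m : M) (t : S) :
    (r ⊗ₜ[ℤ] s : R ⊗[ℤ] S) • (m ⊗ₜ[ℤ] t : M ⊗[ℤ] S) = (r • m) ⊗ₜ[ℤ] (s * t) := by
  change (Algebra.TensorProduct.lift (Algebra.lsmul ℤ ℤ (M ⊗[ℤ] S))
      (rmulHom S M).toIntAlgHom (commute_lsmul_rmul R S M)) (r ⊗ₜ[ℤ] s) (m ⊗ₜ[ℤ] t) = _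
  rw [Algebra.TensorProduct.lift_tmul]
  rfl

variable {p : ℕ} [Fact p.Prime]

theorem exists_eq_tmul_one_add_smul {A : Type*} [AddCommGroup A] (w : A ⊗[ℤ] ℤ_[p]) :
    ∃ (a : A) (w' : A ⊗[ℤ] ℤ_[p]), w = a ⊗ₜ[ℤ] 1 + (p : ℤ) • w' := by
  induction w using TensorProduct.induction_on with
  | zero => exact ⟨0, 0, by simp⟩
  | tmul a s =>
    obtain ⟨t, ht⟩ : ∃ t, s - (s.zmodRepr : ℤ_[p]) = p * t := by
      have := PadicInt.sub_zmodRepr_mem s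
      rwa [PadicInt.maximalIdeal_eq_span_p, Ideal.mem_span_singleton] at this
    refine ⟨(s.zmodRepr : ℤ) • a, a ⊗ₜ t, ?_⟩
    rw [TensorProduct.smul_tmul, ← TensorProduct.tmul_smul, ← TensorProduct.tmul_add]
    congr 1
    simp only [zsmul_eq_mul, Int.cast_natCast, mul_one]
    rw [← ht]
    ring
  | add w₁ w₂ h₁ h₂ =>
    obtain ⟨a₁, w₁', rfl⟩ := h₁
    obtain ⟨a₂, w₂', rfl⟩ := h₂
    refine ⟨a₁ + a₂, w₁' + w₂', ?_⟩
    rw [TensorProduct.add_tmul, smul_add]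
    abel

theorem exists_eq_smul_of_tmul_one_eq_smul {A : Type*} [AddCommGroup A] [Module.Free ℤ A]
    [Module.Finite ℤ A] {a : A} {w : A ⊗[ℤ] ℤ_[p]} (h : a ⊗ₜ[ℤ] 1 = (p : ℤ) • w) :
    ∃ a' : A, a = (p : ℤ) • a' := by
  let b := Module.Free.chooseBasis ℤ A
  have hdvd (i) : (p : ℤ) ∣ b.repr a i := by
    have := congrArg
      ((TensorProduct.lid ℤ ℤ_[p]).toLinearMap ∘ₗ LinearMap.rTensor ℤ_[p] (b.coord i)) h
    rw [map_smul] at this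
    simp only [LinearMap.comp_apply, LinearMap.rTensor_tmul, LinearEquiv.coe_coe,
      TensorProduct.lid_tmul, zsmul_eq_mul, mul_one, Module.Basis.coord_apply,
      Int.cast_natCast] at this
    have hd : (p : ℤ_[p]) ∣ (b.repr a i : ℤ_[p]) := ⟨_, this⟩
    rw [← PadicInt.norm_lt_one_iff_dvd] at hd
    exact (PadicInt.norm_int_lt_one_iff_dvd _).1 hd
  choose c hc using hdvd
  refine ⟨∑ i, c i • b i, ?_⟩
  rw [Finset.smul_sum]
  conv_lhs => rw [← b.sum_repr a]
  exact Finset.sum_congr rfl fun i _ => by rw [hc, mul_smul]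

theorem exists_isGeneratorMod [Module.Free ℤ R] [Module.Finite ℤ R] [Module.Free ℤ M]
    [Module.Finite ℤ M] (b : Module.Basis (Fin 1) (R ⊗[ℤ] ℤ_[p]) (M ⊗[ℤ] ℤ_[p])) :
    ∃ x : M, IsGeneratorMod R p x := by
  obtain ⟨x, w, hx⟩ := exists_eq_tmul_one_add_smul (b 0)
  have hb (v) : ∃ a : R ⊗[ℤ] ℤ_[p], a • b 0 = v := ⟨b.repr v 0, by simpa using b.sum_repr v⟩
  have hb0 (a : R ⊗[ℤ] ℤ_[p]) (ha : a • b 0 = 0) : a = 0 :=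
    Fintype.linearIndependent_iff.1 b.linearIndependent (fun _ => a) (by simpa using ha) 0
  have hr (r : R) : (r ⊗ₜ[ℤ] (1 : ℤ_[p]) : R ⊗[ℤ] ℤ_[p]) • b 0 =
      (r • x) ⊗ₜ[ℤ] 1 + (p : ℤ) • (r ⊗ₜ[ℤ] (1 : ℤ_[p]) : R ⊗[ℤ] ℤ_[p]) • w := by
    rw [hx, smul_add, tmul_smul_tmul, mul_one, smul_comm]
  refine ⟨x, fun m => ?_, fun r m hrm => ?_⟩
  · obtain ⟨a, ha⟩ := hb (m ⊗ₜ 1)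
    obtain ⟨r, a', rfl⟩ := exists_eq_tmul_one_add_smul a
    rw [add_smul, hr, smul_assoc, add_assoc, ← smul_add] at ha
    obtain ⟨m', hm'⟩ := exists_eq_smul_of_tmul_one_eq_smul (a := m - r • x)
      (by rw [TensorProduct.sub_tmul, ← ha, add_sub_cancel_left])
    exact ⟨r, m', by rw [← hm']; abel⟩
  · have h := hr r
    rw [hrm, ← TensorProduct.smul_tmul', ← smul_add] at h
    obtain ⟨a, ha⟩ := hb (m ⊗ₜ[ℤ] 1 + (r ⊗ₜ[ℤ] (1 : ℤ_[p]) : R ⊗[ℤ] ℤ_[p]) • w)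
    rw [← ha, ← AddCommGroup.intIsScalarTower.smul_assoc, ← sub_eq_zero, ← sub_smul] at h
    exact exists_eq_smul_of_tmul_one_eq_smul (sub_eq_zero.1 (hb0 _ h))

end Local

end AlmostIso

open AlmostIso in
/-- Let `Λ` be a ring whose underlying additive group is a free `ℤ`-module of finite
positive rank, such that `Λ ⊗ ℚ` is a semisimple `ℚ`-algebra, and let `M` be a free
abelian group of finite positive rank with a right `Λ`-module structure which is locally
free of rank `1`, i.e. for every prime `ℓ` the right `Λ ⊗ ℤ_ℓ`-module `M ⊗ ℤ_ℓ` is free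
of rank `1`.  Then `M` is a projective right `Λ`-module; more precisely, `M` is
isomorphic to a direct summand of the free right `Λ`-module `Λ ⊕ Λ` of rank `2`. -/
theorem locally_free_rank_one_is_projective_summand_of_rank_two_free
    (Λ M : Type) [Ring Λ]
    [Module.Free ℤ Λ] [Module.Finite ℤ Λ] (hΛrank : 0 < Module.finrank ℤ Λ)
    [IsSemisimpleRing (Λ ⊗[ℤ] ℚ)]
    [AddCommGroup M] [Module Λᵐᵒᵖ M]
    [Module.Free ℤ M] [Module.Finite ℤ M] (hMrank : 0 < Module.finrank ℤ M)
    (hloc : ∀ (ℓ : ℕ) [Fact ℓ.Prime],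
      Nonempty (Module.Basis (Fin 1) (Λᵐᵒᵖ ⊗[ℤ] ℤ_[ℓ]) (M ⊗[ℤ] ℤ_[ℓ]))) :
    Module.Projective Λᵐᵒᵖ M ∧
      ∃ (i : M →ₗ[Λᵐᵒᵖ] Λ × Λ) (p : (Λ × Λ) →ₗ[Λᵐᵒᵖ] M),
        p.comp i = LinearMap.id := by
  have : Module.Free ℤ Λᵐᵒᵖ := Module.Free.of_equiv (MulOpposite.opLinearEquiv ℤ : Λ ≃ₗ[ℤ] Λᵐᵒᵖ)
  have : Module.Finite ℤ Λᵐᵒᵖ :=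
    Module.Finite.equiv (MulOpposite.opLinearEquiv ℤ : Λ ≃ₗ[ℤ] Λᵐᵒᵖ)
  obtain ⟨i, p, hpi⟩ := exists_split_of_isGeneratorMod (R := Λᵐᵒᵖ) (M := M)
    fun ℓ hℓ => haveI : Fact ℓ.Prime := ⟨hℓ⟩; exists_isGeneratorMod (hloc ℓ).some
  let e : Λ ≃ₗ[Λᵐᵒᵖ] Λᵐᵒᵖ :=
    { MulOpposite.opAddEquiv with map_smul' := fun _ _ => rfl }
  let e₂ : (Λ × Λ) ≃ₗ[Λᵐᵒᵖ] Λᵐᵒᵖ × Λᵐᵒᵖ := LinearEquiv.prodCongr e e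
  refine ⟨Module.Projective.of_split i p hpi,
    e₂.symm.toLinearMap.comp i, p.comp e₂.toLinearMap, LinearMap.ext fun m => ?_⟩
  simpa using LinearMap.congr_fun hpi m
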